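/- arXiv:1311.0599 — 2 statements merged into one kernel-verified Lean document; each statement's English description precedes it below -/
import Mathlib

section
/- For positive integers p and q with gcd(p,q) = 1, one has the symmetry N(SU(p),q) = N(SU(q),p), and for every positive integer s also N(SU(p),q,s) = N(SU(q),p,s). -/
open Matrix

/-- The special unitary group `SU(p)`, as a subgroup of the unitary group
`Matrix.unitaryGroup (Fin p) ℂ` consisting of the elements of determinant `1`. -/
noncomputable def SU (p : ℕ) : Subgroup (Matrix.unitaryGroup (Fin p) ℂ) where
  carrier := {x | (x : Matrix (Fin p) (Fin p) ℂ).det = 1}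
  one_mem' := by simp
  mul_mem' := by
    intro a b ha hb
    simp only [Set.mem_setOf_eq, Matrix.UnitaryGroup.mul_val, Matrix.det_mul] at *
    rw [ha, hb, mul_one]
  inv_mem' := by
    intro a ha
    simp only [Set.mem_setOf_eq, Matrix.UnitaryGroup.inv_val, Matrix.star_eq_conjTranspose,
      Matrix.det_conjTranspose] at *
    rw [ha]; simp

/-- `NSU p m` is the number of conjugacy classes of `SU(p)` all of whose elements `x`
satisfy `x ^ m = 1`. -/
noncomputable def NSU (p m : ℕ) : ℕ :=
  {c : ConjClasses (SU p) | ∀ x ∈ c.carrier, x ^ m = 1}.ncard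

/-- `NSUs p m s` is the number of conjugacy classes of `SU(p)` all of whose elements `x`
satisfy `x ^ m = 1` and have exactly `s` distinct eigenvalues (the cardinality of the
spectrum of the underlying complex matrix). -/
noncomputable def NSUs (p m s : ℕ) : ℕ :=
  {c : ConjClasses (SU p) | ∀ x ∈ c.carrier, x ^ m = 1 ∧
      (spectrum ℂ ((x : Matrix.unitaryGroup (Fin p) ℂ) : Matrix (Fin p) (Fin p) ℂ)).ncard = s}.ncard

/-- A unitary matrix of finite order is diagonalized by a unitary matrix. -/
lemma exists_unitary_mul_eq_mul_diagonal {n q : ℕ} (hq : 0 < q) (A : Matrix (Fin n) (Fin n) ℂ)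
    (hA : A ∈ Matrix.unitaryGroup (Fin n) ℂ) (hx : A ^ q = 1) :
    ∃ U ∈ Matrix.unitaryGroup (Fin n) ℂ, ∃ d : Fin n → ℂ, A * U = U * diagonal d := by
  classical
  set T : Module.End ℂ (EuclideanSpace ℂ (Fin n)) := toEuclideanLin A with hT
  have hTq : T ^ q = 1 := by
    rw [hT, ← Matrix.toLpLin_pow, hx, Matrix.toLpLin_one]; rfl
  have hinner : ∀ v w, inner ℂ (T v) (T w) = inner ℂ v w := by
    intro v w
    rw [← LinearMap.adjoint_inner_right, hT, ← Matrix.toEuclideanLin_conjTranspose_eq_adjoint,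
      ← LinearMap.comp_apply]
    rw [show (toEuclideanLin Aᴴ).comp (toEuclideanLin A) = LinearMap.id from ?_]
    · rfl
    · rw [← Matrix.toLpLin_mul_same, ← star_eq_conjTranspose, Matrix.mem_unitaryGroup_iff'.mp hA,
        Matrix.toLpLin_one]
  have hss : T.IsSemisimple := by
    refine Module.End.isSemisimple_of_squarefree_aeval_eq_zero (p := Polynomial.X ^ q - 1)
      (Polynomial.X_pow_sub_one_separable_iff.mpr ?_).squarefree ?_
    · exact_mod_cast hq.ne'
    · simp [hTq]
  have htop := hss.iSup_eigenspace_eq_top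
  have horth : OrthogonalFamily ℂ (fun μ => T.eigenspace μ)
      fun μ => (T.eigenspace μ).subtypeₗᵢ := by
    rintro μ ν hμν ⟨v, hv⟩ ⟨w, hw⟩
    rw [Module.End.mem_eigenspace_iff] at hv hw
    by_cases hv0 : v = 0
    · simp [hv0]
    have h1 := hinner v v
    have h2 := hinner v w
    rw [hv, inner_smul_left, inner_smul_right, ← mul_assoc] at h1
    rw [hv, hw, inner_smul_left, inner_smul_right, ← mul_assoc] at h2
    have h3 : (starRingEnd ℂ) μ * μ = 1 :=
      mul_right_cancel₀ (inner_self_ne_zero.mpr hv0) (by rw [h1, one_mul])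
    change inner ℂ v w = 0
    by_contra h0
    have h4 : (starRingEnd ℂ) μ * ν = 1 := mul_right_cancel₀ h0 (by rw [h2, one_mul])
    exact hμν (mul_left_cancel₀ (left_ne_zero_of_mul_eq_one h3) (h3.trans h4.symm))
  have horth' : OrthogonalFamily ℂ (fun μ : T.Eigenvalues => T.eigenspace μ)
      fun μ => (T.eigenspace μ).subtypeₗᵢ := horth.comp Subtype.val_injective
  have hinternal : DirectSum.IsInternal (fun μ : T.Eigenvalues => T.eigenspace μ) := by
    rw [horth'.isInternal_iff, Submodule.orthogonal_eq_bot_iff, eq_top_iff, ← htop]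
    refine iSup_le fun μ => ?_
    by_cases hμ : T.HasEigenvalue μ
    · exact le_iSup (fun μ : T.Eigenvalues => T.eigenspace μ) ⟨μ, hμ⟩
    · rw [Module.End.hasEigenvalue_iff, not_not] at hμ
      simp [hμ]
  have hn : Module.finrank ℂ (EuclideanSpace ℂ (Fin n)) = n := by simp
  let b := hinternal.subordinateOrthonormalBasis hn horth'
  let d : Fin n → ℂ := fun i => (hinternal.subordinateOrthonormalBasisIndex hn i horth' :
    T.Eigenvalues).1
  have hb : ∀ i, T (b i) = d i • b i := fun i =>
    Module.End.mem_eigenspace_iff.mp (hinternal.subordinateOrthonormalBasis_subordinate hn i horth')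
  refine ⟨(EuclideanSpace.basisFun (Fin n) ℂ).toBasis.toMatrix b,
    (EuclideanSpace.basisFun (Fin n) ℂ).toMatrix_orthonormalBasis_mem_unitary b, d, ?_⟩
  ext i j
  rw [mul_diagonal, mul_comm]
  exact congrArg (fun v : EuclideanSpace ℂ (Fin n) => v i) (hb j)

/-- Families with the same multiset of values differ by a permutation of the indices. -/
lemma exists_perm_comp_eq {n : ℕ} {α : Type*} {d e : Fin n → α}
    (h : Finset.univ.val.map d = Finset.univ.val.map e) :
    ∃ σ : Equiv.Perm (Fin n), e ∘ σ = d := by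
  classical
  have H : ∀ c, Nonempty ({a // d a = c} ≃ {b // e b = c}) := by
    intro c
    have := congrArg (Multiset.count c) h
    rw [Multiset.count_map, Multiset.count_map] at this
    refine Fintype.card_eq.mp ?_
    rw [Fintype.card_subtype, Fintype.card_subtype]
    simpa [eq_comm, Finset.card] using this
  exact ⟨Equiv.ofFiberEquiv fun c => (H c).some, funext fun a => Equiv.ofFiberEquiv_map _ a⟩

/-- A unitary matrix can be rescaled to have determinant one. -/
lemma exists_smul_mem_unitaryGroup_det_eq_one {n : ℕ} (hn : 0 < n) (U : Matrix (Fin n) (Fin n) ℂ)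
    (hU : U ∈ unitaryGroup (Fin n) ℂ) :
    ∃ c : ℂ, c • U ∈ unitaryGroup (Fin n) ℂ ∧ (c • U).det = 1 := by
  have hdet : U.det ∈ unitary ℂ := det_of_mem_unitary hU
  have h1 : ‖U.det‖ = 1 := CStarRing.norm_of_mem_unitary hdet
  have h0 : U.det ≠ 0 := by
    intro h; simp [h] at h1
  obtain ⟨c, hc⟩ := IsAlgClosed.exists_pow_nat_eq (U.det)⁻¹ hn
  have hc1 : ‖c‖ = 1 := by
    refine (pow_eq_one_iff_of_nonneg (norm_nonneg c) hn.ne').mp ?_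
    rw [← norm_pow, hc, norm_inv, h1, inv_one]
  refine ⟨c, ?_, ?_⟩
  · rw [mem_unitaryGroup_iff, star_smul, smul_mul_smul_comm, mem_unitaryGroup_iff.mp hU]
    have : c * star c = 1 := by
      rw [Complex.star_def, Complex.mul_conj, Complex.normSq_eq_norm_sq, hc1]; simp
    rw [this, one_smul]
  · rw [det_smul, Fintype.card_fin, hc, inv_mul_cancel₀ h0]

lemma charpoly_roots_of_mul_eq {n : ℕ} {A U : Matrix (Fin n) (Fin n) ℂ}
    (hU : U ∈ unitaryGroup (Fin n) ℂ) {d : Fin n → ℂ} (h : A * U = U * diagonal d) :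
    A.charpoly.roots = Finset.univ.val.map d := by
  have : A = U * diagonal d * star U := by
    rw [← h, mul_assoc, mem_unitaryGroup_iff.mp hU, mul_one]
  rw [this, charpoly_mul_comm, ← mul_assoc, mem_unitaryGroup_iff'.mp hU, one_mul, charpoly_diagonal]
  have := Polynomial.roots_multiset_prod_X_sub_C (Finset.univ.val.map d)
  rwa [Multiset.map_map] at this

/-- Unitary matrices of finite order with the same characteristic roots are conjugate by a unitary
matrix of determinant one. -/
lemma exists_conj_of_charpoly_roots_eq {n q : ℕ} (hn : 0 < n) (hq : 0 < q)
    {A B : Matrix (Fin n) (Fin n) ℂ}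
    (hA : A ∈ unitaryGroup (Fin n) ℂ) (hB : B ∈ unitaryGroup (Fin n) ℂ)
    (hAq : A ^ q = 1) (hBq : B ^ q = 1) (h : A.charpoly.roots = B.charpoly.roots) :
    ∃ W ∈ unitaryGroup (Fin n) ℂ, W.det = 1 ∧ W * A = B * W := by
  obtain ⟨U, hU, d, hd⟩ := exists_unitary_mul_eq_mul_diagonal hq A hA hAq
  obtain ⟨V, hV, e, he⟩ := exists_unitary_mul_eq_mul_diagonal hq B hB hBq
  rw [charpoly_roots_of_mul_eq hU hd, charpoly_roots_of_mul_eq hV he] at h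
  obtain ⟨σ, rfl⟩ := exists_perm_comp_eq h
  set V' := V.submatrix id σ with hV'
  have hV'u : V' ∈ unitaryGroup (Fin n) ℂ := by
    rw [mem_unitaryGroup_iff, hV', star_eq_conjTranspose, conjTranspose_submatrix,
      submatrix_mul_equiv, ← star_eq_conjTranspose, mem_unitaryGroup_iff.mp hV, submatrix_id_id]
  have he' : B * V' = V' * diagonal (e ∘ σ) := by
    ext i j
    have := congrFun (congrFun he i) (σ j)
    rw [mul_diagonal] at this ⊢
    exact this
  obtain ⟨c, hc, hc1⟩ := exists_smul_mem_unitaryGroup_det_eq_one hn (V' * star U)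
    (mul_mem hV'u (Unitary.star_mem hU))
  refine ⟨_, hc, hc1, ?_⟩
  rw [smul_mul_assoc, mul_smul_comm]
  congr 1
  have h2 : star U * A = diagonal (e ∘ σ) * star U := by
    calc star U * A = star U * (A * U) * star U := by
          rw [mul_assoc, mul_assoc, mem_unitaryGroup_iff.mp hU, mul_one]
      _ = _ := by rw [hd, ← mul_assoc, mem_unitaryGroup_iff'.mp hU, one_mul]
  rw [mul_assoc, h2, ← mul_assoc, ← he', mul_assoc]

/-- The multiset of eigenvalues, with multiplicity, of an element of `SU p`. -/
noncomputable def SU.eigenvalues {p : ℕ} (x : SU p) : Multiset ℂ :=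
  ((x : unitaryGroup (Fin p) ℂ) : Matrix (Fin p) (Fin p) ℂ).charpoly.roots

lemma SU.coe_pow_eq_one_iff {p q : ℕ} (x : SU p) :
    x ^ q = 1 ↔ ((x : unitaryGroup (Fin p) ℂ) : Matrix (Fin p) (Fin p) ℂ) ^ q = 1 := by
  rw [← Subtype.coe_inj, ← Subtype.coe_inj]
  simp

lemma SU.eigenvalues_eq_of_isConj {p : ℕ} {x y : SU p} (h : IsConj x y) :
    SU.eigenvalues x = SU.eigenvalues y := by
  obtain ⟨c, rfl⟩ := isConj_iff.mp h
  have hc : ((c⁻¹ * c : SU p) : unitaryGroup (Fin p) ℂ) = 1 := by simp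
  have hc' := congrArg (fun z : unitaryGroup (Fin p) ℂ => (z : Matrix (Fin p) (Fin p) ℂ)) hc
  simp only [Subgroup.coe_mul, Submonoid.coe_mul, OneMemClass.coe_one] at hc'
  simp only [SU.eigenvalues, Subgroup.coe_mul, Submonoid.coe_mul]
  rw [charpoly_mul_comm, ← mul_assoc, hc', one_mul]

lemma SU.isConj_of_eigenvalues_eq {p q : ℕ} (hp : 0 < p) (hq : 0 < q) {x y : SU p}
    (hx : x ^ q = 1) (hy : y ^ q = 1) (h : SU.eigenvalues x = SU.eigenvalues y) : IsConj x y := by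
  obtain ⟨W, hW, hW1, hWx⟩ := exists_conj_of_charpoly_roots_eq hp hq x.1.2 y.1.2
    ((SU.coe_pow_eq_one_iff x).mp hx) ((SU.coe_pow_eq_one_iff y).mp hy) h
  refine isConj_iff.mpr ⟨⟨⟨W, hW⟩, hW1⟩, ?_⟩
  rw [mul_inv_eq_iff_eq_mul]
  exact Subtype.ext (Subtype.ext hWx)

lemma SU.eigenvalues_prod {p : ℕ} (x : SU p) : (SU.eigenvalues x).prod = 1 := by
  rw [SU.eigenvalues, ← det_eq_prod_roots_charpoly]
  exact x.2

/-- The inclusion of the `q`-th roots of unity into `ℂ`. -/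
noncomputable def rootsOfUnityVal (q : ℕ) : rootsOfUnity q ℂ →* ℂ :=
  (Units.coeHom ℂ).comp (rootsOfUnity q ℂ).subtype

lemma rootsOfUnityVal_injective (q : ℕ) : Function.Injective (rootsOfUnityVal q) :=
  Units.val_injective.comp Subtype.val_injective

lemma rootsOfUnityVal_pow {q : ℕ} (z : rootsOfUnity q ℂ) : rootsOfUnityVal q z ^ q = 1 := by
  rw [← map_pow, show z ^ q = 1 from Subtype.ext z.2, map_one]

lemma SU.exists_map_eq_eigenvalues {p q : ℕ} (hq : 0 < q) {x : SU p} (hx : x ^ q = 1) :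
    ∃ m : Sym (rootsOfUnity q ℂ) p, m.1.prod = 1 ∧
      m.1.map (rootsOfUnityVal q) = SU.eigenvalues x := by
  have : NeZero q := ⟨hq.ne'⟩
  have hx' := (SU.coe_pow_eq_one_iff x).mp hx
  obtain ⟨U, hU, d, hd⟩ := exists_unitary_mul_eq_mul_diagonal hq _ x.1.2 hx'
  have hD : (diagonal d) ^ q = 1 := by
    have h1 : U * diagonal d ^ q = (x : Matrix (Fin p) (Fin p) ℂ) ^ q * U :=
      (SemiconjBy.pow_right (show SemiconjBy U (diagonal d) _ from hd.symm) q)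
    rw [hx', one_mul] at h1
    calc _ = star U * (U * diagonal d ^ q) := by
          rw [← mul_assoc, mem_unitaryGroup_iff'.mp hU, one_mul]
      _ = 1 := by rw [h1, mem_unitaryGroup_iff'.mp hU]
  have hdq : ∀ i, d i ^ q = 1 := by
    intro i
    have := congrFun (congrFun hD i) i
    rwa [diagonal_pow, diagonal_apply_eq, one_apply_eq] at this
  let e : Fin p → rootsOfUnity q ℂ := fun i => rootsOfUnity.mkOfPowEq (d i) (hdq i)
  have hmap : (Finset.univ.val.map e).map (rootsOfUnityVal q) = SU.eigenvalues x := by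
    rw [SU.eigenvalues, charpoly_roots_of_mul_eq hU hd, Multiset.map_map]
    rfl
  refine ⟨⟨Finset.univ.val.map e, by rw [Multiset.card_map]; exact Finset.card_fin p⟩, ?_, hmap⟩
  have h := SU.eigenvalues_prod x
  rw [← hmap, ← map_multiset_prod] at h
  exact rootsOfUnityVal_injective q (h.trans (map_one _).symm)

lemma Sym.exists_eq_map {α : Type*} {p : ℕ} (m : Sym α p) :
    ∃ d : Fin p → α, m.1 = Finset.univ.val.map d := by
  obtain ⟨m, hm⟩ := m
  obtain ⟨l, rfl⟩ : ∃ l : List α, (l : Multiset α) = m := ⟨m.toList, m.coe_toList⟩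
  obtain rfl : l.length = p := hm
  exact ⟨l.get, by rw [Fin.univ_val_map, List.ofFn_get]⟩

lemma SU.exists_eigenvalues_eq_map {p q : ℕ} (hq : 0 < q) (m : Sym (rootsOfUnity q ℂ) p)
    (hm : m.1.prod = 1) :
    ∃ x : SU p, x ^ q = 1 ∧ SU.eigenvalues x = m.1.map (rootsOfUnityVal q) := by
  obtain ⟨d, hd⟩ := m.exists_eq_map
  have hd1 : ∀ i, rootsOfUnityVal q (d i) * star (rootsOfUnityVal q (d i)) = 1 := fun i => by
    have h1 : ‖rootsOfUnityVal q (d i)‖ = 1 :=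
      Complex.norm_eq_one_of_pow_eq_one (rootsOfUnityVal_pow _) hq.ne'
    rw [Complex.star_def, Complex.mul_conj, Complex.normSq_eq_norm_sq, h1]
    simp
  let D : Matrix (Fin p) (Fin p) ℂ := diagonal fun i => rootsOfUnityVal q (d i)
  have hDU : D ∈ unitaryGroup (Fin p) ℂ := by
    rw [mem_unitaryGroup_iff, star_eq_conjTranspose, diagonal_conjTranspose, diagonal_mul_diagonal,
      ← diagonal_one]
    exact congrArg diagonal (funext hd1)
  have hroots : D.charpoly.roots = m.1.map (rootsOfUnityVal q) := by
    rw [charpoly_roots_of_mul_eq (one_mem _) (by rw [mul_one, one_mul]), hd, Multiset.map_map]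
    rfl
  have hdet : D.det = 1 := by
    rw [det_eq_prod_roots_charpoly, hroots, ← map_multiset_prod, hm, map_one]
  refine ⟨⟨⟨D, hDU⟩, hdet⟩, (SU.coe_pow_eq_one_iff _).mpr ?_, hroots⟩
  change D ^ q = 1
  rw [diagonal_pow, ← diagonal_one]
  exact congrArg diagonal (funext fun i => rootsOfUnityVal_pow (d i))

/-- The conjugacy classes of `SU p` of exponent `q` correspond to the multisets of `p` elements of
the group of `q`-th roots of unity with product one. -/
lemma SU.ncard_conjClasses {p q : ℕ} (hp : 0 < p) (hq : 0 < q) (P : Multiset ℂ → Prop) :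
    {c : ConjClasses (SU p) | ∀ x ∈ c.carrier, x ^ q = 1 ∧ P (SU.eigenvalues x)}.ncard =
      {m : Sym (rootsOfUnity q ℂ) p | m.1.prod = 1 ∧ P (m.1.map (rootsOfUnityVal q))}.ncard := by
  let F : ConjClasses (SU p) → Multiset ℂ :=
    Quotient.lift SU.eigenvalues fun x y h => SU.eigenvalues_eq_of_isConj h
  have hF : ∀ x : SU p, F (ConjClasses.mk x) = SU.eigenvalues x := fun x => rfl
  have hself : ∀ x : SU p, x ∈ (ConjClasses.mk x).carrier := fun x =>
    ConjClasses.mem_carrier_iff_mk_eq.mpr rfl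
  let E : Sym (rootsOfUnity q ℂ) p → Multiset ℂ := fun m => m.1.map (rootsOfUnityVal q)
  have hE : Function.Injective E :=
    (Multiset.map_injective (rootsOfUnityVal_injective q)).comp Subtype.val_injective
  rw [← Set.ncard_image_of_injective _ hE, ← Set.InjOn.ncard_image (f := F)]
  · congr 1
    ext s
    constructor
    · rintro ⟨c, hc, rfl⟩
      obtain ⟨x, rfl⟩ := ConjClasses.mk_surjective c
      obtain ⟨hx, hPx⟩ := hc x (hself x)
      obtain ⟨m, hm, hmx⟩ := SU.exists_map_eq_eigenvalues hq hx
      exact ⟨m, ⟨hm, hmx ▸ hPx⟩, hmx⟩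
    · rintro ⟨m, ⟨hm, hPm⟩, rfl⟩
      obtain ⟨x, hx, hxm⟩ := SU.exists_eigenvalues_eq_map hq m hm
      refine ⟨ConjClasses.mk x, fun y hy => ?_, hxm⟩
      have hyx : IsConj y x := ConjClasses.mk_eq_mk_iff_isConj.mp
        (ConjClasses.mem_carrier_iff_mk_eq.mp hy)
      refine ⟨?_, ?_⟩
      · obtain ⟨c, rfl⟩ := isConj_iff.mp hyx.symm
        rw [conj_pow, hx, mul_one, mul_inv_cancel]
      · rw [SU.eigenvalues_eq_of_isConj hyx, hxm]
        exact hPm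
  · intro c hc c' hc' h
    obtain ⟨x, rfl⟩ := ConjClasses.mk_surjective c
    obtain ⟨y, rfl⟩ := ConjClasses.mk_surjective c'
    exact ConjClasses.mk_eq_mk_iff_isConj.mpr (SU.isConj_of_eigenvalues_eq hp hq
      (hc x (hself x)).1 (hc' y (hself y)).1 h)

lemma NSU_eq {p q : ℕ} (hp : 0 < p) (hq : 0 < q) :
    NSU p q = {m : Sym (rootsOfUnity q ℂ) p | m.1.prod = 1}.ncard := by
  simpa [NSU] using SU.ncard_conjClasses hp hq fun _ => True

lemma NSUs_eq {p q : ℕ} (s : ℕ) (hp : 0 < p) (hq : 0 < q) :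
    NSUs p q s =
      {m : Sym (rootsOfUnity q ℂ) p | m.1.prod = 1 ∧ m.1.toFinset.card = s}.ncard := by
  have hspec : ∀ x : SU p, spectrum ℂ ((x : unitaryGroup (Fin p) ℂ) : Matrix (Fin p) (Fin p) ℂ) =
      (SU.eigenvalues x).toFinset := by
    intro x
    ext z
    rw [mem_spectrum_iff_isRoot_charpoly, Finset.mem_coe, Multiset.mem_toFinset, SU.eigenvalues,
      Polynomial.mem_roots (charpoly_monic _).ne_zero]
  have hmap : ∀ m : Multiset (rootsOfUnity q ℂ),
      (m.map (rootsOfUnityVal q)).toFinset.card = m.toFinset.card := by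
    intro m
    rw [Multiset.toFinset_map, Finset.card_image_of_injective _ (rootsOfUnityVal_injective q)]
  simpa only [NSUs, hspec, Set.ncard_coe_finset, hmap] using
    SU.ncard_conjClasses hp hq fun m => m.toFinset.card = s

/-- If the order of `G` is coprime to `n`, then any multiset of `n` elements of `G` has exactly one
translate with product one. -/
lemma Sym.natCard_mul_ncard_prod_eq_one_and {G : Type*} [CommGroup G] {n : ℕ}
    (hn : (Nat.card G).Coprime n) (P : Multiset G → Prop)
    (hP : ∀ (z : G) (m : Multiset G), P m → P (m.map (z * ·))) :
    Nat.card G * {m : Sym G n | m.1.prod = 1 ∧ P m.1}.ncard = {m : Sym G n | P m.1}.ncard := by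
  have hprod : ∀ (z : G) (m : Sym G n), (m.1.map (z * ·)).prod = z ^ n * m.1.prod := by
    intro z m
    rw [Multiset.prod_map_mul, Multiset.map_const', Multiset.prod_replicate, m.2, Multiset.map_id']
  let f : G × {m : Sym G n | m.1.prod = 1 ∧ P m.1} → {m : Sym G n | P m.1} := fun x =>
    ⟨⟨x.2.1.1.map (x.1 * ·), by rw [Multiset.card_map]; exact x.2.1.2⟩, hP _ _ x.2.2.2⟩
  have hf : Function.Bijective f := by
    constructor
    · rintro ⟨z, m, hm, hmP⟩ ⟨w, l, hl, hlP⟩ h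
      have h' : m.1.map (z * ·) = l.1.map (w * ·) := congrArg (fun y => y.1.1) h
      have hzw := congrArg Multiset.prod h'
      rw [hprod, hprod, hm, hl, mul_one, mul_one] at hzw
      obtain rfl := hn.pow_left_bijective.1 hzw
      obtain rfl := Subtype.ext (Multiset.map_injective (mul_right_injective z) h')
      rfl
    · rintro ⟨m, hm⟩
      obtain ⟨z, hz⟩ := hn.pow_left_bijective.2 m.1.prod
      refine ⟨(z, ⟨⟨m.1.map (z⁻¹ * ·), by rw [Multiset.card_map]; exact m.2⟩, ?_, hP _ _ hm⟩), ?_⟩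
      · rw [hprod, ← hz, inv_pow, inv_mul_cancel]
      · refine Subtype.ext (Subtype.ext ?_)
        change (m.1.map (z⁻¹ * ·)).map (z * ·) = m.1
        simp
  rw [← Nat.card_coe_set_eq, ← Nat.card_coe_set_eq, ← Nat.card_prod]
  exact Nat.card_eq_of_bijective f hf

lemma Sym.card_filter_toFinset_eq {α : Type*} [Fintype α] [DecidableEq α] (n : ℕ) (T : Finset α) :
    (Finset.univ.filter fun m : Sym α n => m.1.toFinset = T).card =
      if T.card ≤ n then T.card.multichoose (n - T.card) else 0 := by
  split_ifs with h
  · rw [← Fintype.card_coe T, ← Sym.card_sym_eq_multichoose, Fintype.card_coe,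
      ← Fintype.card_subtype]
    have hcard : ∀ m : Sym T (n - T.card), (m.1.map Subtype.val + T.val).card = n := by
      intro m
      rw [Multiset.card_add, Multiset.card_map, m.2, Finset.card_val]
      omega
    have hsupp : ∀ m : Sym T (n - T.card), (m.1.map Subtype.val + T.val).toFinset = T := by
      intro m
      ext a
      have : a ∈ m.1.map Subtype.val → a ∈ T := by
        intro ha
        obtain ⟨b, -, rfl⟩ := Multiset.mem_map.mp ha
        exact b.2
      simp only [Multiset.mem_toFinset, Multiset.mem_add, Finset.mem_val]
      tauto
    let f : Sym T (n - T.card) → {m : Sym α n // m.1.toFinset = T} := fun m =>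
      ⟨⟨m.1.map Subtype.val + T.val, hcard m⟩, hsupp m⟩
    refine (Fintype.card_congr (Equiv.ofBijective f ⟨?_, ?_⟩)).symm
    · intro m l h
      have h' : m.1.map Subtype.val + T.val = l.1.map Subtype.val + T.val :=
        congrArg (fun y => y.1.1) h
      exact Subtype.ext (Multiset.map_injective Subtype.val_injective (add_right_cancel h'))
    · rintro ⟨m, rfl⟩
      have hle : m.1.toFinset.val ≤ m.1 := Multiset.dedup_le _
      have hmem : ∀ a ∈ m.1 - m.1.toFinset.val, a ∈ m.1.toFinset := fun a ha =>
        Multiset.mem_toFinset.mpr (Multiset.mem_of_le (Multiset.sub_le_self _ _) ha)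
      obtain ⟨l, hl⟩ := CanLift.prf (β := Multiset m.1.toFinset) (m.1 - m.1.toFinset.val) hmem
      refine ⟨⟨l, ?_⟩, ?_⟩
      · rw [← Multiset.card_map Subtype.val l, hl, Multiset.card_sub hle, Finset.card_val]
        exact congrArg (· - _) m.2
      · refine Subtype.ext (Subtype.ext ?_)
        change l.map Subtype.val + m.1.toFinset.val = m.1
        rw [hl, tsub_add_cancel_of_le hle]
  · rw [Finset.card_eq_zero, Finset.filter_eq_empty_iff]
    rintro m - rfl
    refine h ?_
    have := Multiset.toFinset_card_le m.1
    rwa [m.2] at this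

lemma Sym.card_filter_card_toFinset_eq {α : Type*} [Fintype α] [DecidableEq α] (n s : ℕ) :
    (Finset.univ.filter fun m : Sym α n => m.1.toFinset.card = s).card =
      (Fintype.card α).choose s * if s ≤ n then s.multichoose (n - s) else 0 := by
  rw [Finset.card_eq_sum_card_fiberwise (f := fun m : Sym α n => m.1.toFinset)
    (t := Finset.univ.powersetCard s)]
  · rw [← Finset.card_univ, ← Finset.card_powersetCard, ← smul_eq_mul, ← Finset.sum_const]
    refine Finset.sum_congr rfl fun T hT => ?_
    obtain rfl := (Finset.mem_powersetCard.mp hT).2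
    rw [← Sym.card_filter_toFinset_eq, Finset.filter_filter]
    congr 1
    ext m
    simp only [Finset.mem_filter, Finset.mem_univ, true_and, and_iff_right_iff_imp]
    rintro rfl
    rfl
  · intro m hm
    exact Finset.mem_coe.mpr (Finset.mem_powersetCard_univ.mpr
      (Finset.mem_filter.mp (Finset.mem_coe.mp hm)).2)

lemma Sym.mul_ncard_prod_eq_one_and_card {G : Type*} [CommGroup G] [Finite G] [DecidableEq G] {n s : ℕ}
    (hn : (Nat.card G).Coprime n) (hn0 : 0 < n) (hs : 0 < s) :
    s * {m : Sym G n | m.1.prod = 1 ∧ m.1.toFinset.card = s}.ncard =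
      (Nat.card G - 1).choose (s - 1) * (n - 1).choose (s - 1) := by
  have := Fintype.ofFinite G
  have h := Sym.natCard_mul_ncard_prod_eq_one_and hn (fun m => m.toFinset.card = s) (by
    intro z m hm
    rw [Multiset.toFinset_map, Finset.card_image_of_injective _ (mul_right_injective z), hm])
  have h2 : {m : Sym G n | m.1.toFinset.card = s}.ncard =
      (Nat.card G).choose s * (n - 1).choose (s - 1) := by
    rw [Set.ncard_eq_toFinset_card', Set.toFinset_ofPred, Sym.card_filter_card_toFinset_eq,
      Nat.card_eq_fintype_card]
    congr 1
    split_ifs with hsn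
    · rw [Nat.multichoose_eq, show s + (n - s) - 1 = n - 1 by omega,
        ← Nat.choose_symm_of_eq_add (show n - 1 = (s - 1) + (n - s) by omega)]
    · rw [Nat.choose_eq_zero_of_lt (by omega)]
  rw [h2] at h
  have hG : 0 < Nat.card G := Nat.card_pos
  obtain ⟨k, hk⟩ := Nat.exists_eq_succ_of_ne_zero hG.ne'
  obtain ⟨t, rfl⟩ := Nat.exists_eq_succ_of_ne_zero hs.ne'
  rw [hk] at h ⊢
  have h3 := Nat.add_one_mul_choose_eq k t
  refine Nat.eq_of_mul_eq_mul_left (Nat.succ_pos k) ?_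
  simp only [Nat.succ_eq_add_one, Nat.add_sub_cancel] at *
  calc _ = (t + 1) * ((k + 1) * {m : Sym G n | m.1.prod = 1 ∧ m.1.toFinset.card = t + 1}.ncard) := by
        ring
    _ = (k + 1).choose (t + 1) * (t + 1) * (n - 1).choose t := by rw [h]; ring
    _ = _ := by rw [← h3]; ring

lemma Sym.natCard_mul_ncard_prod_eq_one {G : Type*} [CommGroup G] {n : ℕ}
    (hn : (Nat.card G).Coprime n) :
    Nat.card G * {m : Sym G n | m.1.prod = 1}.ncard = (Nat.card G + n - 1).choose n := by
  rw [← Sym.natCard_sym_eq_choose, ← Set.ncard_univ]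
  simpa using Sym.natCard_mul_ncard_prod_eq_one_and hn (fun _ => True) (fun _ _ h => h)

/-- For coprime positive integers `p` and `q`, `N(SU(p), q) = N(SU(q), p)`, and for every
positive integer `s` also `N(SU(p), q, s) = N(SU(q), p, s)`. -/
theorem stmt_4 (p q : ℕ) (hp : 0 < p) (hq : 0 < q) (hpq : Nat.gcd p q = 1) :
    NSU p q = NSU q p ∧ ∀ s : ℕ, 0 < s → NSUs p q s = NSUs q p s := by
  have : NeZero p := ⟨hp.ne'⟩
  have : NeZero q := ⟨hq.ne'⟩
  have hcp : Nat.card (rootsOfUnity p ℂ) = p := Complex.card_rootsOfUnity p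
  have hcq : Nat.card (rootsOfUnity q ℂ) = q := Complex.card_rootsOfUnity q
  have hp_cop : (Nat.card (rootsOfUnity p ℂ)).Coprime q := by rw [hcp]; exact hpq
  have hq_cop : (Nat.card (rootsOfUnity q ℂ)).Coprime p := by rw [hcq]; exact Nat.Coprime.symm hpq
  constructor
  · have h1 := Sym.natCard_mul_ncard_prod_eq_one hq_cop
    have h2 := Sym.natCard_mul_ncard_prod_eq_one hp_cop
    rw [← NSU_eq hp hq, hcq] at h1
    rw [← NSU_eq hq hp, hcp] at h2
    obtain ⟨a, rfl⟩ := Nat.exists_eq_succ_of_ne_zero hp.ne'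
    have h3 := Nat.choose_succ_right_eq (q + a) a
    have h4 : (q + a).choose a = (q + a).choose q := (Nat.choose_symm_add (a := q) (b := a)).symm
    rw [show q + a - a = q by omega, h4] at h3
    rw [show q + a.succ - 1 = q + a by omega] at h1
    rw [show a.succ + q - 1 = q + a by omega] at h2
    refine Nat.eq_of_mul_eq_mul_left (Nat.mul_pos hp hq) ?_
    calc a.succ * q * NSU a.succ q = (q + a).choose (a + 1) * (a + 1) := by
          rw [mul_assoc, h1]; exact mul_comm _ _
      _ = a.succ * q * NSU q a.succ := by rw [h3, ← h2]; ring
  · intro s hs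
    have h1 := Sym.mul_ncard_prod_eq_one_and_card hq_cop hp hs
    have h2 := Sym.mul_ncard_prod_eq_one_and_card hp_cop hq hs
    rw [hcq] at h1
    rw [hcp] at h2
    rw [NSUs_eq s hp hq, NSUs_eq s hq hp]
    refine Nat.eq_of_mul_eq_mul_left hs ?_
    exact h1.trans ((mul_comm _ _).trans h2.symm)
end

section
/- For any positive integers n and m, the number of conjugacy classes of the compact symplectic group Sp(n) consisting of elements x with x^m = 1 equals C(n + ⌊m/2⌋, ⌊m/2⌋). -/
open Matrix

/-- The compact symplectic group `Sp(n)`, as the subgroup of the unitary group of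
`2n × 2n` complex matrices (indexed by `Fin n ⊕ Fin n`) consisting of those matrices whose
underlying matrix lies in the symplectic group (preserves the standard symplectic form `J`). -/
noncomputable def Sp (n : ℕ) : Subgroup (Matrix.unitaryGroup (Fin n ⊕ Fin n) ℂ) where
  carrier := {x | (x : Matrix (Fin n ⊕ Fin n) (Fin n ⊕ Fin n) ℂ) ∈ Matrix.symplecticGroup (Fin n) ℂ}
  one_mem' := (Matrix.symplecticGroup (Fin n) ℂ).one_mem
  mul_mem' := fun ha hb => (Matrix.symplecticGroup (Fin n) ℂ).mul_mem ha hb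
  inv_mem' := by
    intro x hx
    have h1 : ((x⁻¹ : Matrix.unitaryGroup (Fin n ⊕ Fin n) ℂ) : Matrix (Fin n ⊕ Fin n) (Fin n ⊕ Fin n) ℂ)
        = (x : Matrix (Fin n ⊕ Fin n) (Fin n ⊕ Fin n) ℂ)⁻¹ := by
      rw [Matrix.UnitaryGroup.inv_val]
      exact (Matrix.inv_eq_left_inv (Matrix.UnitaryGroup.star_mul_self x)).symm
    have h2 : ((x : Matrix (Fin n ⊕ Fin n) (Fin n ⊕ Fin n) ℂ))⁻¹ ∈ Matrix.symplecticGroup (Fin n) ℂ := by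
      rw [← SymplecticGroup.coe_inv' ⟨_, hx⟩]
      exact ((⟨_, hx⟩ : Matrix.symplecticGroup (Fin n) ℂ)⁻¹).2
    simpa only [Set.mem_setOf_eq, h1] using h2

/-- The quaternionic structure `v ↦ J v̄` on `ℂ²ⁿ`. -/
noncomputable def quatConj {n : ℕ} (v : Fin n ⊕ Fin n → ℂ) : Fin n ⊕ Fin n → ℂ :=
  J (Fin n) ℂ *ᵥ star v

section quatConj

variable {n : ℕ} (u v : Fin n ⊕ Fin n → ℂ)

@[simp]
theorem quatConj_inl (i : Fin n) : quatConj v (Sum.inl i) = -star (v (Sum.inr i)) := by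
  simp [quatConj, J, mulVec, dotProduct, Matrix.one_apply]

@[simp]
theorem quatConj_inr (i : Fin n) : quatConj v (Sum.inr i) = star (v (Sum.inl i)) := by
  simp [quatConj, J, mulVec, dotProduct, Matrix.one_apply]

theorem quatConj_quatConj : quatConj (quatConj v) = -v := by
  ext (i | i) <;> simp

theorem quatConj_smul (c : ℂ) : quatConj (c • v) = star c • quatConj v := by
  ext (i | i) <;> simp

theorem star_dotProduct_quatConj : star u ⬝ᵥ quatConj v = -(star v ⬝ᵥ quatConj u) := by
  simp only [dotProduct, Fintype.sum_sum_type, quatConj_inl, quatConj_inr, Pi.star_apply]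
  simp only [mul_neg, Finset.sum_neg_distrib, mul_comm]
  ring

theorem star_dotProduct_quatConj_self : star v ⬝ᵥ quatConj v = 0 :=
  self_eq_neg.mp (star_dotProduct_quatConj v v)

theorem star_quatConj_dotProduct_quatConj :
    star (quatConj u) ⬝ᵥ quatConj v = star v ⬝ᵥ u := by
  simp only [dotProduct, Fintype.sum_sum_type, quatConj_inl, quatConj_inr, Pi.star_apply]
  simp only [star_neg, star_star, neg_mul_neg, mul_comm]
  ring

theorem star_dotProduct_comm : star u ⬝ᵥ v = star (star v ⬝ᵥ u) := by
  rw [star_dotProduct]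

end quatConj

section unitary

variable {ι : Type*} [Fintype ι] [DecidableEq ι] {A : Matrix ι ι ℂ}

theorem star_mulVec_dotProduct_mulVec (hA : star A * A = 1) (u v : ι → ℂ) :
    star (A *ᵥ u) ⬝ᵥ (A *ᵥ v) = star u ⬝ᵥ v := by
  rw [star_mulVec, ← dotProduct_mulVec, mulVec_mulVec, ← star_eq_conjTranspose, hA, one_mulVec]

theorem star_mul_self_eigenvalue (hA : star A * A = 1) {v : ι → ℂ} {c : ℂ}
    (hv : star v ⬝ᵥ v = 1) (hc : A *ᵥ v = c • v) : star c * c = 1 := by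
  simpa [hc, hv, star_smul, mul_comm c] using star_mulVec_dotProduct_mulVec hA v v

theorem star_dotProduct_mulVec_eq_zero (hA : star A * A = 1) {v x : ι → ℂ} {c : ℂ}
    (hv : star v ⬝ᵥ v = 1) (hc : A *ᵥ v = c • v) (hx : star v ⬝ᵥ x = 0) :
    star v ⬝ᵥ (A *ᵥ x) = 0 := by
  have h := star_mulVec_dotProduct_mulVec hA v x
  have hc1 := star_mul_self_eigenvalue hA hv hc
  rw [hc, hx, star_smul, smul_dotProduct, smul_eq_mul] at h
  exact (mul_eq_zero.mp h).resolve_left (left_ne_zero_of_mul_eq_one hc1)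

end unitary

theorem mul_J_eq_J_mul_map_star {n : ℕ} {A : Matrix (Fin n ⊕ Fin n) (Fin n ⊕ Fin n) ℂ}
    (hA : star A * A = 1) (hs : A ∈ symplecticGroup (Fin n) ℂ) :
    A * J (Fin n) ℂ = J (Fin n) ℂ * A.map star := by
  have h1 : Aᵀ * A.map star = 1 := by
    have := congrArg transpose hA
    rwa [transpose_mul, star_eq_conjTranspose, conjTranspose, transpose_map,
      transpose_transpose, transpose_one] at this
  rw [← SymplecticGroup.mem_iff.mp hs, Matrix.mul_assoc _ Aᵀ, h1, Matrix.mul_one,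
    SymplecticGroup.mem_iff.mp hs]

theorem mulVec_quatConj {n : ℕ} {A : Matrix (Fin n ⊕ Fin n) (Fin n ⊕ Fin n) ℂ}
    (hA : star A * A = 1) (hs : A ∈ symplecticGroup (Fin n) ℂ) (v : Fin n ⊕ Fin n → ℂ) :
    A *ᵥ quatConj v = quatConj (A *ᵥ v) := by
  have : star (A *ᵥ v) = A.map star *ᵥ star v := by
    ext i
    simp [mulVec, dotProduct]
  rw [quatConj, quatConj, this, mulVec_mulVec, mulVec_mulVec, mul_J_eq_J_mul_map_star hA hs]

/-- A family of eigenvectors of `A`, with eigenvalues in the closed upper half plane, that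
together with its image under `quatConj` is orthonormal. -/
structure IsSymplecticEigenframe {n k : ℕ} (A : Matrix (Fin n ⊕ Fin n) (Fin n ⊕ Fin n) ℂ)
    (v : Fin k → Fin n ⊕ Fin n → ℂ) (c : Fin k → ℂ) : Prop where
  orthonormal : ∀ i j, star (v i) ⬝ᵥ v j = if i = j then 1 else 0
  isotropic : ∀ i j, star (v i) ⬝ᵥ quatConj (v j) = 0
  eigen : ∀ i, A *ᵥ v i = c i • v i
  im_nonneg : ∀ i, 0 ≤ (c i).im

theorem exists_normalized_eigenvector {ι : Type*} [Fintype ι] (A : Matrix ι ι ℂ)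
    (W : Submodule ℂ (ι → ℂ)) (hW : W ≠ ⊥) (hA : ∀ x ∈ W, A *ᵥ x ∈ W) :
    ∃ x ∈ W, ∃ c : ℂ, A *ᵥ x = c • x ∧ star x ⬝ᵥ x = 1 := by
  classical
  have : Nontrivial W := Submodule.nontrivial_iff_ne_bot.mpr hW
  obtain ⟨c, hc⟩ := Module.End.exists_eigenvalue ((toLin' A).restrict (p := W) (q := W)
    fun x hx => by simpa using hA x hx)
  obtain ⟨⟨x, hxW⟩, hx⟩ := hc.exists_hasEigenvector
  have hx0 : x ≠ 0 := fun h => hx.2 (by simpa using h)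
  have hAx : A *ᵥ x = c • x := by
    simpa using congrArg Subtype.val hx.apply_eq_smul
  let r : ℝ := ∑ i, ‖x i‖ ^ 2
  have hr : star x ⬝ᵥ x = (r : ℂ) := by
    simp [r, dotProduct, ← Complex.conj_mul']
  have hr0 : 0 < r := by
    refine lt_of_le_of_ne (Finset.sum_nonneg fun i _ => by positivity) fun h => hx0 ?_
    ext i
    simpa using (Finset.sum_eq_zero_iff_of_nonneg fun i _ => by positivity).mp h.symm i
      (Finset.mem_univ i)
  let s : ℝ := (√r)⁻¹
  have hs : s * (s * r) = 1 := by
    have h1 : √r ≠ 0 := (Real.sqrt_pos.mpr hr0).ne'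
    simp only [s]
    field_simp
    rw [Real.sq_sqrt hr0.le]
  refine ⟨(s : ℂ) • x, W.smul_mem _ hxW, c, ?_, ?_⟩
  · rw [mulVec_smul, hAx, smul_comm]
  · rw [star_smul, smul_dotProduct, dotProduct_smul, hr]
    simpa using mod_cast hs

theorem IsSymplecticEigenframe.exists_cons {n k : ℕ}
    {A : Matrix (Fin n ⊕ Fin n) (Fin n ⊕ Fin n) ℂ}
    (hA : star A * A = 1) (hs : A ∈ symplecticGroup (Fin n) ℂ)
    {v : Fin k → Fin n ⊕ Fin n → ℂ} {c : Fin k → ℂ} (h : IsSymplecticEigenframe A v c)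
    (hk : k < n) :
    ∃ x a, IsSymplecticEigenframe (k := k + 1) A (Fin.cons x v) (Fin.cons a c) := by
  let W : Submodule ℂ (Fin n ⊕ Fin n → ℂ) := LinearMap.ker (mulVecLin
    (Matrix.of (Sum.elim (fun i => star (v i)) fun i => star (quatConj (v i)))))
  have hWiff (x) : x ∈ W ↔ ∀ i, star (v i) ⬝ᵥ x = 0 ∧ star (quatConj (v i)) ⬝ᵥ x = 0 := by
    simp only [W, LinearMap.mem_ker, mulVecLin_apply, funext_iff, mulVec, Sum.forall, of_apply,
      Sum.elim_inl, Sum.elim_inr, Pi.zero_apply, forall_and]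
  have hvv (i) : star (v i) ⬝ᵥ v i = 1 := by simp [h.orthonormal]
  have hW : W ≠ ⊥ := LinearMap.ker_ne_bot_of_finrank_lt (by simp; omega)
  have hWA : ∀ x ∈ W, A *ᵥ x ∈ W := by
    intro x hx
    rw [hWiff] at hx ⊢
    refine fun i => ⟨star_dotProduct_mulVec_eq_zero hA (hvv i) (h.eigen i) (hx i).1,
      star_dotProduct_mulVec_eq_zero hA (c := star (c i)) ?_ ?_ (hx i).2⟩
    · rw [star_quatConj_dotProduct_quatConj, hvv]
    · rw [mulVec_quatConj hA hs, h.eigen, quatConj_smul]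
  have hWq : ∀ x ∈ W, quatConj x ∈ W := by
    intro x hx
    rw [hWiff] at hx ⊢
    intro i
    constructor
    · rw [star_dotProduct_quatConj, star_dotProduct_comm, (hx i).2, star_zero, neg_zero]
    · rw [star_quatConj_dotProduct_quatConj, star_dotProduct_comm, (hx i).1, star_zero]
  obtain ⟨x, hxW, a, hxa, hxx, ha⟩ : ∃ x ∈ W, ∃ a : ℂ, A *ᵥ x = a • x ∧
      star x ⬝ᵥ x = 1 ∧ 0 ≤ a.im := by
    obtain ⟨x, hxW, a, hxa, hxx⟩ := exists_normalized_eigenvector A W hW hWA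
    rcases le_total 0 a.im with ha | ha
    · exact ⟨x, hxW, a, hxa, hxx, ha⟩
    · refine ⟨quatConj x, hWq x hxW, star a, ?_, ?_, by simpa using ha⟩
      · rw [mulVec_quatConj hA hs, hxa, quatConj_smul]
      · rw [star_quatConj_dotProduct_quatConj, hxx]
  have hx1 := fun i => ((hWiff x).mp hxW i).1
  have hx2 := fun i => ((hWiff _).mp (hWq x hxW) i).1
  refine ⟨x, a, ⟨fun i j => ?_, fun i j => ?_, fun i => ?_, fun i => ?_⟩⟩
  · cases i using Fin.cases <;> cases j using Fin.cases
    · simpa using hxx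
    · rw [star_dotProduct_comm]
      simp [hx1, (Fin.succ_ne_zero _).symm]
    · simp [hx1]
    · simp [h.orthonormal]
  · cases i using Fin.cases <;> cases j using Fin.cases
    · simpa using star_dotProduct_quatConj_self x
    · rw [star_dotProduct_quatConj]
      simp [hx2]
    · simp [hx2]
    · simp [h.isotropic]
  · cases i using Fin.cases
    · simpa using hxa
    · simp [h.eigen]
  · cases i using Fin.cases
    · simpa using ha
    · simp [h.im_nonneg]

theorem exists_isSymplecticEigenframe {n : ℕ} {A : Matrix (Fin n ⊕ Fin n) (Fin n ⊕ Fin n) ℂ}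
    (hA : star A * A = 1) (hs : A ∈ symplecticGroup (Fin n) ℂ) (k : ℕ) (hk : k ≤ n) :
    ∃ (v : Fin k → Fin n ⊕ Fin n → ℂ) (c : Fin k → ℂ), IsSymplecticEigenframe A v c := by
  induction k with
  | zero => exact ⟨Fin.elim0, Fin.elim0, by constructor <;> exact fun i => i.elim0⟩
  | succ k ih =>
    obtain ⟨v, c, h⟩ := ih (by omega)
    obtain ⟨x, a, hx⟩ := h.exists_cons hA hs (by omega)
    exact ⟨_, _, hx⟩

namespace Sp

variable {n : ℕ}

theorem star_mul_self (x : Sp n) :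
    star (x.1.1 : Matrix (Fin n ⊕ Fin n) (Fin n ⊕ Fin n) ℂ) * x.1.1 = 1 :=
  UnitaryGroup.star_mul_self x.1

/-- The element of `Sp(n)` determined by a unitary symplectic matrix. -/
noncomputable def ofMatrix (M : Matrix (Fin n ⊕ Fin n) (Fin n ⊕ Fin n) ℂ)
    (hM : star M * M = 1) (hs : M ∈ symplecticGroup (Fin n) ℂ) : Sp n :=
  ⟨⟨M, mem_unitaryGroup_iff'.mpr hM⟩, hs⟩

theorem _root_.Circle.conj_mul_coe (z : Circle) : (starRingEnd ℂ) z * z = 1 := by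
  rw [Complex.conj_mul', Circle.norm_coe, Complex.ofReal_one, one_pow]

theorem _root_.Circle.coe_mul_conj (z : Circle) : (z : ℂ) * (starRingEnd ℂ) z = 1 := by
  rw [mul_comm, Circle.conj_mul_coe]

/-- The diagonal element of `Sp(n)` with entries `z₁, …, zₙ, z̄₁, …, z̄ₙ`. -/
noncomputable def diag (z : Fin n → Circle) : Sp n :=
  ofMatrix (diagonal (Sum.elim (fun i => (z i : ℂ)) fun i => star (z i : ℂ)))
    (by
      rw [star_eq_conjTranspose, diagonal_conjTranspose, diagonal_mul_diagonal,
        diagonal_eq_one]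
      ext (i | i) <;> simp [Circle.conj_mul_coe, Circle.coe_mul_conj])
    (by
      rw [SymplecticGroup.mem_iff, ← fromBlocks_diagonal, J, fromBlocks_transpose,
        fromBlocks_multiply, fromBlocks_multiply]
      simp [Circle.conj_mul_coe, Circle.coe_mul_conj, ← diagonal_one])

theorem coe_diag (z : Fin n → Circle) : ((diag z).1.1 : Matrix _ _ ℂ) =
    diagonal (Sum.elim (fun i => (z i : ℂ)) fun i => star (z i : ℂ)) := rfl

theorem coe_pow (x : Sp n) (m : ℕ) : ((x ^ m).1.1 : Matrix _ _ ℂ) = x.1.1 ^ m := rfl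

theorem coe_mul (x y : Sp n) : ((x * y).1.1 : Matrix _ _ ℂ) = x.1.1 * y.1.1 := rfl

theorem ext_coe {x y : Sp n} (h : (x.1.1 : Matrix _ _ ℂ) = y.1.1) : x = y :=
  Subtype.ext (Subtype.ext h)

theorem diag_pow_eq_one_iff (z : Fin n → Circle) (m : ℕ) :
    diag z ^ m = 1 ↔ ∀ i, (z i : ℂ) ^ m = 1 := by
  have h : diag z ^ m = 1 ↔ ((diag z ^ m).1.1 : Matrix _ _ ℂ) = 1 :=
    ⟨fun h => by rw [h]; rfl, fun h => ext_coe h⟩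
  rw [h, coe_pow, coe_diag, diagonal_pow, diagonal_eq_one]
  refine ⟨fun h i => by simpa using congrFun h (Sum.inl i), fun h => ?_⟩
  ext (i | i)
  · simp [h]
  · simp [← map_pow, h]

theorem isConj_diag (x : Sp n) {v : Fin n → Fin n ⊕ Fin n → ℂ} {z : Fin n → Circle}
    (h : IsSymplecticEigenframe (x.1.1 : Matrix _ _ ℂ) v fun i => (z i : ℂ)) :
    IsConj (diag z) x := by
  let M : Matrix (Fin n ⊕ Fin n) (Fin n ⊕ Fin n) ℂ :=
    Matrix.of fun r s => Sum.elim v (fun i => quatConj (v i)) s r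
  have hinl (i r) : M r (Sum.inl i) = v i r := rfl
  have hinr (i r) : M r (Sum.inr i) = quatConj (v i) r := rfl
  have hentry (r s) : (star M * M) r s = star (fun t => M t r) ⬝ᵥ fun t => M t s := by
    simp [mul_apply, star_eq_conjTranspose, dotProduct]
  have hM : star M * M = 1 := by
    ext r s
    rw [hentry]
    rcases r with i | i <;> rcases s with j | j
    · simp [hinl, h.orthonormal, one_apply]
    · simp [hinl, hinr, h.isotropic]
    · rw [star_dotProduct_comm]
      simp [hinl, hinr, h.isotropic]
    · simp [hinr, star_quatConj_dotProduct_quatConj, h.orthonormal, one_apply, eq_comm]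
  have hMJ : M * J (Fin n) ℂ = J (Fin n) ℂ * M.map star := by
    ext r s
    have : (J (Fin n) ℂ * M.map star) r s = quatConj (fun t => M t s) r := rfl
    rw [this]
    rcases s with i | i
    · simp [mul_apply, J, one_apply, hinl, hinr]
    · simp [mul_apply, J, one_apply, hinl, hinr, quatConj_quatConj]
  have hMs : M ∈ symplecticGroup (Fin n) ℂ := by
    have h1 : M.map star * Mᵀ = 1 := by
      have := congrArg transpose (mul_eq_one_comm.mp hM)
      rwa [transpose_mul, star_eq_conjTranspose, conjTranspose, transpose_map,
        transpose_transpose, transpose_one] at this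
    rw [SymplecticGroup.mem_iff, hMJ, Matrix.mul_assoc, h1, Matrix.mul_one]
  refine isConj_iff.mpr ⟨ofMatrix M hM hMs, ?_⟩
  rw [mul_inv_eq_iff_eq_mul]
  apply ext_coe
  rw [coe_mul, coe_mul, coe_diag]
  change M * _ = x.1.1 * M
  ext r s
  have : (x.1.1 * M) r s = ((x.1.1 : Matrix _ _ ℂ) *ᵥ fun t => M t s) r := rfl
  rw [this, mul_diagonal]
  rcases s with i | i
  · simp [hinl, h.eigen, mul_comm]
  · simp [hinr, mulVec_quatConj (star_mul_self x) x.2, h.eigen, quatConj_smul, mul_comm]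

theorem exists_eigenframe (x : Sp n) :
    ∃ (v : Fin n → Fin n ⊕ Fin n → ℂ) (z : Fin n → Circle),
      IsSymplecticEigenframe (x.1.1 : Matrix _ _ ℂ) v fun i => (z i : ℂ) := by
  obtain ⟨v, c, h⟩ := exists_isSymplecticEigenframe (star_mul_self x) x.2 n le_rfl
  have hc (i) : c i ∈ Submonoid.unitSphere ℂ := by
    have := star_mul_self_eigenvalue (star_mul_self x) (by simp [h.orthonormal i i]) (h.eigen i)
    rw [RCLike.star_def, Complex.conj_mul'] at this
    have h2 : ‖c i‖ ^ 2 = 1 := mod_cast this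
    exact mem_sphere_zero_iff_norm.mpr
      ((pow_eq_one_iff_of_nonneg (norm_nonneg _) two_ne_zero).mp h2)
  exact ⟨v, fun i => ⟨c i, hc i⟩, h⟩

theorem map_re_eq_of_isConj_diag {z w : Fin n → Circle} (h : IsConj (diag z) (diag w)) :
    (Finset.univ.val.map fun i => (z i : ℂ).re) = Finset.univ.val.map fun i => (w i : ℂ).re := by
  have key (z : Fin n → Circle) : ((diag z).1.1 : Matrix _ _ ℂ).charpoly.roots.map Complex.re =
      2 • Finset.univ.val.map fun i => (z i : ℂ).re := by
    rw [coe_diag, charpoly_diagonal, Polynomial.roots_prod]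
    · simp only [Polynomial.roots_X_sub_C, Multiset.bind_singleton, Multiset.map_map,
        ← Finset.univ_disjSum_univ, Finset.val_disjSum, Multiset.disjSum, Multiset.map_add,
        two_nsmul]
      simp [Function.comp_def]
    · exact Finset.prod_ne_zero_iff.mpr fun i _ => Polynomial.X_sub_C_ne_zero _
  obtain ⟨g, hg⟩ := isConj_iff.mp h
  have hchar : ((diag w).1.1 : Matrix _ _ ℂ).charpoly = (diag z).1.1.charpoly := by
    have h1 : (diag w).1.1 = (g.1.1 * (diag z).1.1) * star g.1.1 := by rw [← hg]; rfl
    rw [h1, charpoly_mul_comm, ← Matrix.mul_assoc, star_mul_self, Matrix.one_mul]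
  have h2 : 2 • (Finset.univ.val.map fun i => (z i : ℂ).re) =
      2 • Finset.univ.val.map fun i => (w i : ℂ).re := by rw [← key, ← key, hchar]
  ext a
  have := congrArg (Multiset.count a) h2
  rw [Multiset.count_nsmul, Multiset.count_nsmul] at this
  omega

end Sp

theorem exists_perm_of_map_univ_eq {n : ℕ} {α : Type*} [LinearOrder α] {f g : Fin n → α}
    (h : Finset.univ.val.map f = Finset.univ.val.map g) : ∃ σ : Equiv.Perm (Fin n), f ∘ σ = g := by
  have hl : (List.ofFn f).Perm (List.ofFn g) := by
    rw [← Multiset.coe_eq_coe]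
    simpa [Fin.univ_val_map] using h
  have hp : (List.ofFn (f ∘ Tuple.sort f)).Perm (List.ofFn (g ∘ Tuple.sort g)) :=
    ((Equiv.Perm.ofFn_comp_perm _ f).trans hl).trans (Equiv.Perm.ofFn_comp_perm _ g).symm
  have he : f ∘ Tuple.sort f = g ∘ Tuple.sort g :=
    List.ofFn_injective (hp.eq_of_pairwise (fun _ _ _ _ => le_antisymm)
      (List.sortedLE_ofFn_iff.mpr (Tuple.monotone_sort f)).pairwise
      (List.sortedLE_ofFn_iff.mpr (Tuple.monotone_sort g)).pairwise)
  refine ⟨(Tuple.sort g).symm.trans (Tuple.sort f), ?_⟩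
  ext i
  simpa using congrFun he ((Tuple.sort g).symm i)

/-- The `m`-th root of unity `exp(2πij/m)`, for `j ≤ m/2`: these are the `m`-th roots of unity
in the closed upper half plane. -/
noncomputable def upperRoot (m : ℕ) (j : Fin (m / 2 + 1)) : Circle :=
  Circle.exp (2 * Real.pi * j / m)

section upperRoot

variable {m : ℕ}

theorem upperRoot_pow (hm : 0 < m) (j : Fin (m / 2 + 1)) : (upperRoot m j : ℂ) ^ m = 1 := by
  rw [upperRoot, Circle.coe_exp, ← Complex.exp_nat_mul, Complex.exp_eq_one_iff]
  refine ⟨j, ?_⟩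
  have : (m : ℂ) ≠ 0 := by exact_mod_cast hm.ne'
  push_cast
  field_simp

theorem exists_upperRoot_eq (hm : 0 < m) {z : Circle} (hz : (z : ℂ) ^ m = 1)
    (him : 0 ≤ (z : ℂ).im) : ∃ j, upperRoot m j = z := by
  have : NeZero m := ⟨hm.ne'⟩
  obtain ⟨i, hi, hiz⟩ := (Complex.isPrimitiveRoot_exp m hm.ne').eq_pow_of_pow_eq_one hz
  have hexp : Circle.exp (2 * Real.pi * i / m) = z := by
    ext
    rw [Circle.coe_exp, ← hiz, ← Complex.exp_nat_mul]
    push_cast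
    congr 1
    ring
  have hm' : (0 : ℝ) < m := by exact_mod_cast hm
  have hle : i ≤ m / 2 := by
    by_contra hlt
    have h2 : (m : ℝ) < 2 * i := by exact_mod_cast (by omega : m < 2 * i)
    have h3 : (i : ℝ) < m := by exact_mod_cast hi
    have hsin : 0 ≤ Real.sin (2 * Real.pi * i / m) := by
      rwa [← hexp, Circle.coe_exp, Complex.exp_ofReal_mul_I_im] at him
    have hneg : Real.sin (2 * Real.pi * i / m - 2 * Real.pi) < 0 := by
      apply Real.sin_neg_of_neg_of_neg_pi_lt
      · rw [sub_neg, div_lt_iff₀ hm']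
        nlinarith [Real.pi_pos]
      · rw [lt_sub_iff_add_lt, lt_div_iff₀ hm']
        nlinarith [Real.pi_pos]
    rw [Real.sin_sub_two_pi] at hneg
    exact absurd hsin hneg.not_ge
  exact ⟨⟨i, by omega⟩, hexp⟩

theorem upperRoot_re_injective (hm : 0 < m) :
    Function.Injective fun j => (upperRoot m j : ℂ).re := by
  have hm' : (0 : ℝ) < m := by exact_mod_cast hm
  have hmem (j : Fin (m / 2 + 1)) : 2 * Real.pi * j / m ∈ Set.Icc 0 Real.pi := by
    have h2 : 2 * (j : ℝ) ≤ m := by exact_mod_cast (by omega : 2 * (j : ℕ) ≤ m)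
    refine ⟨by positivity, ?_⟩
    rw [div_le_iff₀ hm']
    nlinarith [Real.pi_pos]
  intro i j hij
  simp only [upperRoot, Circle.coe_exp, Complex.exp_ofReal_mul_I_re] at hij
  have h := Real.injOn_cos (hmem i) (hmem j) hij
  have hpi := Real.pi_ne_zero
  field_simp at h
  exact Fin.ext (by exact_mod_cast h)

end upperRoot

theorem Sym.exists_map_univ_eq {α : Type*} {n : ℕ} (s : Sym α n) :
    ∃ f : Fin n → α, Finset.univ.val.map f = (s : Multiset α) := by
  obtain ⟨l, hl⟩ := Quotient.exists_rep (s : Multiset α)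
  have hlen : l.length = n := (congrArg Multiset.card hl).trans s.2
  subst hlen
  exact ⟨l.get, by rw [Fin.univ_val_map, List.ofFn_get]; exact hl⟩

/-- For any positive integers `n` and `m`, the number of conjugacy classes of the compact
symplectic group `Sp(n)` consisting of elements `x` with `x ^ m = 1` equals
`C(n + ⌊m/2⌋, ⌊m/2⌋)`. -/
theorem stmt_8 (n m : ℕ) (hn : 0 < n) (hm : 0 < m) :
    {c : ConjClasses (Sp n) | ∀ x ∈ c.carrier, x ^ m = 1}.ncard
      = Nat.choose (n + m / 2) (m / 2) := by
  choose f hf using fun s : Sym (Fin (m / 2 + 1)) n => s.exists_map_univ_eq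
  let F : Sym (Fin (m / 2 + 1)) n → ConjClasses (Sp n) :=
    fun s => ConjClasses.mk (Sp.diag fun i => upperRoot m (f s i))
  have hinj : Function.Injective F := by
    intro s t hst
    have h := Sp.map_re_eq_of_isConj_diag (ConjClasses.mk_eq_mk_iff_isConj.mp hst)
    apply Sym.coe_injective
    apply Multiset.map_injective (upperRoot_re_injective hm)
    simpa [← hf, Function.comp_def] using h
  have hrange : {c : ConjClasses (Sp n) | ∀ x ∈ c.carrier, x ^ m = 1} = Set.range F := by
    ext c
    constructor
    · intro hc
      obtain ⟨x, rfl⟩ := ConjClasses.exists_rep c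
      obtain ⟨v, z, h⟩ := Sp.exists_eigenframe x
      have hz := (Sp.diag_pow_eq_one_iff z m).mp
        (hc _ (ConjClasses.mem_carrier_iff_mk_eq.mpr
          (ConjClasses.mk_eq_mk_iff_isConj.mpr (Sp.isConj_diag x h))))
      choose j hj using fun i => exists_upperRoot_eq hm (hz i) (h.im_nonneg i)
      obtain rfl : (fun i => upperRoot m (j i)) = z := funext hj
      let s : Sym (Fin (m / 2 + 1)) n := ⟨Finset.univ.val.map j, by simp⟩
      obtain ⟨σ, hσ⟩ := exists_perm_of_map_univ_eq (f := j) (g := f s) (hf s).symm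
      refine ⟨s, ConjClasses.mk_eq_mk_iff_isConj.mpr (Sp.isConj_diag x (v := v ∘ σ) ?_)⟩
      rw [← hσ]
      exact ⟨fun a b => by simp [h.orthonormal], fun a b => h.isotropic _ _,
        fun a => h.eigen _, fun a => h.im_nonneg _⟩
    · rintro ⟨s, rfl⟩ x hx
      have hx' := ConjClasses.mk_eq_mk_iff_isConj.mp (ConjClasses.mem_carrier_iff_mk_eq.mp hx)
      have h1 := (Sp.diag_pow_eq_one_iff (fun i => upperRoot m (f s i)) m).mpr
        fun i => upperRoot_pow hm _
      have h2 := hx'.symm.pow m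
      rw [h1] at h2
      exact isConj_one_right.mp h2
  rw [hrange, Set.ncard_range_of_injective hinj, Nat.card_eq_fintype_card,
    Sym.card_sym_eq_choose, Fintype.card_fin]
  rw [show m / 2 + 1 + n - 1 = n + m / 2 by omega, Nat.choose_symm_add]
end
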